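/- In the setting below, if d is the least nonnegative integer such that B^d lies in M_s(ℚ)·B^{d+1} (i.e., B^d = C·B^{d+1} for some s×s matrix C with rational entries), then l Fin dim Λ ≤ d. -/

import Mathlib

open CategoryTheory

universe u

section Preamble

variable (R : Type u) [Ring R]

/-- `PdimLE R n M` : the left `R`-module `M` has projective dimension at most `n`,
i.e. it admits a projective resolution of length at most `n`. -/
def PdimLE : ℕ → ModuleCat.{u} R → Prop
  | 0, M => Module.Projective R M
  | n + 1, M =>
    ∃ (P : ModuleCat.{u} R) (f : ↥P →ₗ[R] ↥M),
      Module.Projective R ↥P ∧ Function.Surjective f ∧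
        PdimLE n (ModuleCat.of R (LinearMap.ker f))

/-- `M` has projective dimension exactly `d`. -/
def PdimEq (M : ModuleCat.{u} R) (d : ℕ) : Prop :=
  PdimLE R d M ∧ ∀ k, PdimLE R k M → d ≤ k

/-- The projective dimension of `M`, as an element of `ℕ∞` (`⊤` = infinite). -/
noncomputable def pdim (M : ModuleCat.{u} R) : ℕ∞ :=
  sInf {d : ℕ∞ | ∃ n : ℕ, d = n ∧ PdimLE R n M}

/-- `IdimLE R n M` : the left `R`-module `M` has injective dimension at most `n`. -/
def IdimLE : ℕ → ModuleCat.{u} R → Prop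
  | 0, M => Module.Injective R M
  | n + 1, M =>
    ∃ (E : ModuleCat.{u} R) (f : ↥M →ₗ[R] ↥E),
      Module.Injective R ↥E ∧ Function.Injective f ∧
        IdimLE n (ModuleCat.of R (↥E ⧸ LinearMap.range f))

/-- The injective dimension of `M`, as an element of `ℕ∞`. -/
noncomputable def idim (M : ModuleCat.{u} R) : ℕ∞ :=
  sInf {d : ℕ∞ | ∃ n : ℕ, d = n ∧ IdimLE R n M}

/-- The (left) big finitistic dimension of `R`: the supremum of the projective
dimensions of all (left) `R`-modules of finite projective dimension. -/
noncomputable def bigFinDim : ℕ∞ :=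
  sSup {d : ℕ∞ | d ≠ ⊤ ∧ ∃ M : ModuleCat.{u} R, pdim R M = d}

/-- The (left) little finitistic dimension of `R`: the supremum of the projective
dimensions of all finitely generated (left) `R`-modules of finite projective dimension. -/
noncomputable def littleFinDim : ℕ∞ :=
  sSup {d : ℕ∞ | d ≠ ⊤ ∧ ∃ M : ModuleCat.{u} R, Module.Finite R ↥M ∧ pdim R M = d}

/-- The (left) global dimension of `R`, as an element of `ℕ∞`. -/
noncomputable def glDim : ℕ∞ :=
  sInf {d : ℕ∞ | ∃ n : ℕ, d = n ∧ ∀ M : ModuleCat.{u} R, PdimLE R n M}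

/-- `A` is (isomorphic to) a direct summand of `B`. -/
def IsSummand (A B : ModuleCat.{u} R) : Prop :=
  ∃ C : ModuleCat.{u} R, Nonempty ((↥A × ↥C) ≃ₗ[R] ↥B)

/-- A minimal projective resolution of `M`, recorded through its syzygies:
`Ω 0 ≅ M`, and for each `n` the map `f n : P n → Ω n` is a projective cover
(i.e. `P n` is projective, `f n` is surjective and its kernel is superfluous in `P n`),
with `Ω (n+1) ≅ ker (f n)`. -/
structure SyzygyChain (M : ModuleCat.{u} R) : Type (u + 1) where
  Ω : ℕ → ModuleCat.{u} R
  P : ℕ → ModuleCat.{u} R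
  projective : ∀ n, Module.Projective R ↥(P n)
  f : ∀ n, ↥(P n) →ₗ[R] ↥(Ω n)
  surj : ∀ n, Function.Surjective (f n)
  minimal : ∀ n, ∀ N : Submodule R ↥(P n), N ⊔ LinearMap.ker (f n) = ⊤ → N = ⊤
  iso0 : Nonempty (↥(Ω 0) ≃ₗ[R] ↥M)
  isoSucc : ∀ n, Nonempty (↥(Ω (n + 1)) ≃ₗ[R] ↥(LinearMap.ker (f n)))

/-- The minimal projective resolution is repetitive at degree `k`: the `k`-th
syzygy decomposes as `P ⊕ ⨁ᵢ Aᵢ` with `P` projective and each `Aᵢ` a direct summand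
of infinitely many syzygies. -/
def RepAt {M : ModuleCat.{u} R} (c : SyzygyChain R M) (k : ℕ) : Prop :=
  ∃ (ι : Type u) (A : ι → ModuleCat.{u} R) (P : ModuleCat.{u} R),
    Module.Projective R ↥P ∧
    (∀ i, {j : ℕ | IsSummand R (A i) (c.Ω j)}.Infinite) ∧
    Nonempty (↥(c.Ω k) ≃ₗ[R] (↥P × DirectSum ι fun i => ↥(A i)))

/-- The repetition index of a module (with a given minimal projective resolution),
as an element of `ℕ∞`. -/
noncomputable def repIndex {M : ModuleCat.{u} R} (c : SyzygyChain R M) : ℕ∞ :=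
  sInf {d : ℕ∞ | ∃ k : ℕ, d = k ∧ RepAt R c k}

/-- The (left) global repetition index of `R`. -/
noncomputable def glRep : ℕ∞ :=
  sSup {d : ℕ∞ | ∃ (M : ModuleCat.{u} R) (c : SyzygyChain R M), repIndex R c = d}

/-- The syzygy category of `M` (given a minimal projective resolution `c` of `M`)
is a Krull-Schmidt category of finite representation type, with the `s` modules
`A 0, …, A (s-1)` as representatives of the isomorphism classes of its nonzero
indecomposable objects: the `A i` have local endomorphism rings, are pairwise
non-isomorphic, each occurs as a direct summand of some syzygy, and every syzygy
is a finite direct sum of copies of the `A i`. -/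
def HasSyzygyType {M : ModuleCat.{u} R} (c : SyzygyChain R M) (s : ℕ)
    (A : Fin s → ModuleCat.{u} R) : Prop :=
  (∀ i, IsLocalRing (Module.End R ↥(A i))) ∧
  (∀ i j : Fin s, i ≠ j → IsEmpty (↥(A i) ≃ₗ[R] ↥(A j))) ∧
  (∀ i, ∃ j, IsSummand R (A i) (c.Ω j)) ∧
  (∀ j, ∃ m : Fin s → ℕ, Nonempty (↥(c.Ω j) ≃ₗ[R] ((i : Fin s) → Fin (m i) → ↥(A i))))

/-- Truncating a minimal projective resolution of `M` gives a minimal projective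
resolution of the `m`-th syzygy of `M`. -/
def SyzygyChain.shift {M : ModuleCat.{u} R} (c : SyzygyChain R M) (m : ℕ) :
    SyzygyChain R (c.Ω m) where
  Ω := fun j => c.Ω (m + j)
  P := fun j => c.P (m + j)
  projective := fun j => c.projective (m + j)
  f := fun j => c.f (m + j)
  surj := fun j => c.surj (m + j)
  minimal := fun j => c.minimal (m + j)
  iso0 := ⟨LinearEquiv.refl R ↥(c.Ω (m + 0))⟩
  isoSucc := fun j => c.isoSucc (m + j)

/-- The radical (Jacobson radical) of `R` as a left module over itself:
the intersection of all maximal submodules. -/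
def ringRadical : Submodule R R := sInf {m : Submodule R R | IsCoatom m}

/-- `R / rad R` as a left `R`-module. -/
noncomputable abbrev radQuot : ModuleCat.{u} R := ModuleCat.of R (R ⧸ ringRadical R)

/-- `X` embeds into `T`. -/
def EmbedsIn (X T : ModuleCat.{u} R) : Prop := ∃ g : ↥X →ₗ[R] ↥T, Function.Injective g

/-- The homological contingency of `A` to `M` (with minimal projective resolution `c`)
equals the integer `z`: `z` is the greatest element of `{-1} ∪ {j | A is a direct
summand of Ω^j(M)}`.  (So `z = -1` iff `A` is a summand of no syzygy, and no such `z`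
exists iff the contingency is infinite.) -/
def ContEq {M : ModuleCat.{u} R} (c : SyzygyChain R M) (A : ModuleCat.{u} R) (z : ℤ) : Prop :=
  IsGreatest (insert (-1) ((fun j : ℕ => (j : ℤ)) '' {j | IsSummand R A (c.Ω j)})) z

/-- `E` is an injective envelope of `X`: `E` is injective and contains a copy of `X`
as an essential submodule. -/
def IsInjectiveEnvelopeOf (X E : ModuleCat.{u} R) : Prop :=
  ∃ f : ↥X →ₗ[R] ↥E, Module.Injective R ↥E ∧ Function.Injective f ∧
    ∀ N : Submodule R ↥E, N ≠ ⊥ → N ⊓ LinearMap.range f ≠ ⊥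

end Preamble

section TorK

variable (K : Type u) [Field K] (Λ : Type u) [Ring Λ] [Algebra K Λ]

/-- The `K`-dimension of the balanced tensor product `A ⊗_Λ M` of a right
`Λ`-module `A` and a left `Λ`-module `M`, realized as the quotient of `A ⊗_K M`
by the balancing relations.  (The `K`-structures are the canonical ones obtained
by restriction along `algebraMap`.) -/
noncomputable def balTenDim (A M : Type u) [AddCommGroup A] [Module Λᵐᵒᵖ A]
    [AddCommGroup M] [Module Λ M] : ℕ :=
  letI : Module K A := Module.compHom A (algebraMap K Λᵐᵒᵖ)
  letI : Module K M := Module.compHom M (algebraMap K Λ)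
  Module.finrank K ((TensorProduct K A M) ⧸
    Submodule.span K {x : TensorProduct K A M | ∃ (a : A) (l : Λ) (m : M),
      x = (MulOpposite.op l • a) ⊗ₜ[K] m - a ⊗ₜ[K] (l • m)})

/-- The `K`-dimension of `Tor₁^Λ(A, ·)` computed from a projective presentation:
given a `Λ`-linear map `g : N → P` (to be used with `N = ker(P → M)` and `g` the
inclusion, for a projective cover `P → M`), this is the `K`-dimension of the kernel
of the induced map `A ⊗_Λ N → A ⊗_Λ P` on balanced tensor products. -/
noncomputable def torOneDim (A N P : Type u) [AddCommGroup A] [Module Λᵐᵒᵖ A]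
    [AddCommGroup N] [Module Λ N] [AddCommGroup P] [Module Λ P] (g : N →ₗ[Λ] P) : ℕ :=
  letI : Module K A := Module.compHom A (algebraMap K Λᵐᵒᵖ)
  letI : Module K N := Module.compHom N (algebraMap K Λ)
  letI : Module K P := Module.compHom P (algebraMap K Λ)
  Module.finrank K ↥(LinearMap.ker (Submodule.mapQ
    (Submodule.span K {x : TensorProduct K A N | ∃ (a : A) (l : Λ) (m : N),
      x = (MulOpposite.op l • a) ⊗ₜ[K] m - a ⊗ₜ[K] (l • m)})
    (Submodule.span K {x : TensorProduct K A P | ∃ (a : A) (l : Λ) (m : P),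
      x = (MulOpposite.op l • a) ⊗ₜ[K] m - a ⊗ₜ[K] (l • m)})
    (TensorProduct.map LinearMap.id
      ({ toFun := g
         map_add' := g.map_add
         map_smul' := fun k x => g.map_smul (algebraMap K Λ k) x } : N →ₗ[K] P))
    (by
      rw [← Submodule.map_le_iff_le_comap, Submodule.map_span]
      apply Submodule.span_le.2
      rintro x ⟨y, ⟨a, l, m, rfl⟩, rfl⟩
      apply Submodule.subset_span
      exact ⟨a, l, g m, by simp [map_sub, g.map_smul]⟩)))

end TorK

open LinearMap (ker range comp_assoc id_comp comp_sub add_comp codRestrict_apply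
  subtype_comp_codRestrict)

section Dual

variable {R : Type*} [Ring R]

/-- The character module of a right module is a left module. -/
instance characterModuleOfRight (X : Type*) [AddCommGroup X] [Module Rᵐᵒᵖ X] :
    Module R (CharacterModule X) where
  smul r c := AddMonoidHom.comp c (DistribSMul.toAddMonoidHom X (MulOpposite.op r))
  one_smul c := CharacterModule.ext _ fun x => congrArg c (one_smul Rᵐᵒᵖ x)
  mul_smul r r' c := CharacterModule.ext _ fun x =>
    congrArg c (mul_smul (MulOpposite.op r') (MulOpposite.op r) x)
  smul_zero _ := rfl
  smul_add _ _ _ := rfl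
  add_smul r r' c := CharacterModule.ext _ fun x =>
    (congrArg c (add_smul (MulOpposite.op r) (MulOpposite.op r') x)).trans (map_add c _ _)
  zero_smul c := CharacterModule.ext _ fun x =>
    (congrArg c (zero_smul Rᵐᵒᵖ x)).trans (map_zero c)

/-- The character module of a left module is a right module. -/
instance characterModuleOfLeft (Y : Type*) [AddCommGroup Y] [Module R Y] :
    Module Rᵐᵒᵖ (CharacterModule Y) where
  smul r c := AddMonoidHom.comp c (DistribSMul.toAddMonoidHom Y r.unop)
  one_smul c := CharacterModule.ext _ fun y => congrArg c (one_smul R y)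
  mul_smul r r' c := CharacterModule.ext _ fun y => congrArg c (mul_smul r'.unop r.unop y)
  smul_zero _ := rfl
  smul_add _ _ _ := rfl
  add_smul r r' c := CharacterModule.ext _ fun y =>
    (congrArg c (add_smul r.unop r'.unop y)).trans (map_add c _ _)
  zero_smul c := CharacterModule.ext _ fun y => (congrArg c (zero_smul R y)).trans (map_zero c)

variable {X Y : Type*} [AddCommGroup X] [Module Rᵐᵒᵖ X] [AddCommGroup Y] [Module Rᵐᵒᵖ Y]

theorem characterModule_sum_apply {ι X : Type*} [AddCommGroup X] (t : Finset ι)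
    (c : ι → CharacterModule X) (x : X) : (∑ i ∈ t, c i) x = ∑ i ∈ t, c i x :=
  map_sum (AddMonoidHom.eval x : (X →+ AddCircle (1 : ℚ)) →+ _) c t

/-- The left-linear map between character modules induced by a right-linear map. -/
def rightDual (g : X →ₗ[Rᵐᵒᵖ] Y) : CharacterModule Y →ₗ[R] CharacterModule X where
  toFun c := AddMonoidHom.comp c g.toAddMonoidHom
  map_add' _ _ := rfl
  map_smul' r c := CharacterModule.ext _ fun x => congrArg c (g.map_smul (MulOpposite.op r) x).symm

@[simp]
theorem rightDual_apply (g : X →ₗ[Rᵐᵒᵖ] Y) (c : CharacterModule Y) (x : X) :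
    rightDual g c x = c (g x) := rfl

theorem exists_character_comp_eq {Y Z : Type*} [AddCommGroup Y] [AddCommGroup Z] (g : Y →+ Z)
    (hg : Function.Injective g) (c : CharacterModule Y) :
    ∃ c' : CharacterModule Z, ∀ y, c' (g y) = c y := by
  obtain ⟨c', h⟩ := CharacterModule.dual_surjective_of_injective g.toIntLinearMap hg c
  exact ⟨c', fun y => congrArg (fun a : CharacterModule Y => a y) h⟩

theorem rightDual_surjective {g : X →ₗ[Rᵐᵒᵖ] Y} (hg : Function.Injective g) :
    Function.Surjective (rightDual g) := fun c => by
  obtain ⟨c', h⟩ := exists_character_comp_eq g.toAddMonoidHom hg c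
  exact ⟨c', CharacterModule.ext _ h⟩

theorem rightDual_injective {g : X →ₗ[Rᵐᵒᵖ] Y} (hg : Function.Surjective g) :
    Function.Injective (rightDual g) := fun c c' h => CharacterModule.ext _ fun y => by
  obtain ⟨x, rfl⟩ := hg y
  exact congrArg (fun a : CharacterModule X => a x) h

theorem rightDual_exact {g : X →ₗ[Rᵐᵒᵖ] Y} (hg : Function.Surjective g)
    (c : CharacterModule X) (hc : rightDual (ker g).subtype c = 0) : ∃ c', rightDual g c' = c := by
  have hk : (g.toAddMonoidHom).ker ≤ AddMonoidHom.ker (c : X →+ AddCircle (1 : ℚ)) := fun x hx =>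
    congrArg (fun a : CharacterModule (ker g) => a ⟨x, hx⟩) hc
  refine ⟨AddMonoidHom.liftOfSurjective g.toAddMonoidHom hg ⟨c, hk⟩,
    CharacterModule.ext _ fun x => ?_⟩
  exact AddMonoidHom.liftOfRightInverse_comp_apply _ _
    (Function.rightInverse_surjInv hg) ⟨c, hk⟩ x

/-- The character module of a projective right module is injective. -/
theorem exists_extend_characterModule [Module.Projective Rᵐᵒᵖ X]
    {Y Z : Type*} [AddCommGroup Y] [Module R Y] [AddCommGroup Z] [Module R Z]
    (i : Y →ₗ[R] Z) (hi : Function.Injective i) (h : Y →ₗ[R] CharacterModule X) :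
    ∃ e : Z →ₗ[R] CharacterModule X, e ∘ₗ i = h := by
  let restrict : CharacterModule Z →ₗ[Rᵐᵒᵖ] CharacterModule Y :=
    { toFun := fun c => AddMonoidHom.comp c i.toAddMonoidHom
      map_add' := fun _ _ => rfl
      map_smul' := fun r c => CharacterModule.ext _ fun y => congrArg c (i.map_smul r.unop y).symm }
  have hrestrict : Function.Surjective restrict := fun c => by
    obtain ⟨c', h⟩ := exists_character_comp_eq i.toAddMonoidHom hi c
    exact ⟨c', CharacterModule.ext _ h⟩
  let flip : X →ₗ[Rᵐᵒᵖ] CharacterModule Y :=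
    { toFun := fun x => AddMonoidHom.mk' (fun y => h y x) fun y y' => by rw [map_add]; rfl
      map_add' := fun x x' => CharacterModule.ext _ fun y => map_add (h y) x x'
      map_smul' := fun r x => CharacterModule.ext _ fun y =>
        (congrArg (fun c : CharacterModule X => c x) (h.map_smul r.unop y)).symm }
  obtain ⟨l, hl⟩ := Module.projective_lifting_property restrict flip hrestrict
  refine ⟨{ toFun := fun z => AddMonoidHom.mk' (fun x => l x z) fun x x' => by rw [map_add]; rfl
            map_add' := fun z z' => CharacterModule.ext _ fun x => map_add (l x) z z'
            map_smul' := fun r z => CharacterModule.ext _ fun x =>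
              (congrArg (fun c : CharacterModule Z => c z)
                (l.map_smul (MulOpposite.op r) x)).symm }, ?_⟩
  ext y x
  exact congrArg (fun a : CharacterModule Y => a y) (LinearMap.congr_fun hl x)

end Dual

section Extension

variable {R : Type*} [Ring R] {P M : Type*} [AddCommGroup P] [Module R P]
  [AddCommGroup M] [Module R M]

/-- Every linear map from `ker f` to `X` extends to the source of `f`. For a projective
presentation `f` of `M` this says that `Ext¹(M, X) = 0`. -/
def ExtendsFromKer (f : P →ₗ[R] M) (X : Type*) [AddCommGroup X] [Module R X] : Prop :=
  ∀ h : ker f →ₗ[R] X, ∃ e : P →ₗ[R] X, e ∘ₗ (ker f).subtype = h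

variable {X I Y : Type*} [AddCommGroup X] [Module R X] [AddCommGroup I] [Module R I]
  [AddCommGroup Y] [Module R Y] {f : P →ₗ[R] M}

theorem ExtendsFromKer.of_retract (hY : ExtendsFromKer f Y) (a : X →ₗ[R] Y) (b : Y →ₗ[R] X)
    (h : b ∘ₗ a = LinearMap.id) : ExtendsFromKer f X := fun g => by
  obtain ⟨e, he⟩ := hY (a ∘ₗ g)
  exact ⟨b ∘ₗ e, by rw [comp_assoc, he, ← comp_assoc, h, id_comp]⟩

theorem ExtendsFromKer.pi {ι : Type*} {X : ι → Type*} [∀ i, AddCommGroup (X i)]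
    [∀ i, Module R (X i)] (h : ∀ i, ExtendsFromKer f (X i)) : ExtendsFromKer f (∀ i, X i) :=
  fun g => by
    choose e he using fun i => h i (LinearMap.proj i ∘ₗ g)
    exact ⟨LinearMap.pi e, LinearMap.ext fun x => funext fun i => LinearMap.congr_fun (he i) x⟩

theorem ExtendsFromKer.of_submodule_quotient [Module.Projective R P] (N : Submodule R X)
    (hN : ExtendsFromKer f N) (hQ : ExtendsFromKer f (X ⧸ N)) : ExtendsFromKer f X := fun g => by
  obtain ⟨e, he⟩ := hQ (N.mkQ ∘ₗ g)
  obtain ⟨l, hl⟩ := Module.projective_lifting_property N.mkQ e N.mkQ_surjective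
  have key : ∀ x, (g - l ∘ₗ (ker f).subtype) x ∈ N := fun x => by
    rw [← N.ker_mkQ, LinearMap.mem_ker, ← LinearMap.comp_apply, comp_sub, ← comp_assoc, hl,
      he, sub_self]
    rfl
  obtain ⟨e', he'⟩ := hN ((g - l ∘ₗ (ker f).subtype).codRestrict N key)
  refine ⟨l + N.subtype ∘ₗ e', ?_⟩
  rw [add_comp, comp_assoc, he', subtype_comp_codRestrict]
  abel

/-- Transfer along a surjection when `ker f` is projective. -/
theorem ExtendsFromKer.of_surjective [Module.Projective R (ker f)] (hY : ExtendsFromKer f Y)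
    (b : Y →ₗ[R] X) (hb : Function.Surjective b) : ExtendsFromKer f X := fun g => by
  obtain ⟨l, hl⟩ := Module.projective_lifting_property b g hb
  obtain ⟨e, he⟩ := hY l
  exact ⟨b ∘ₗ e, by rw [comp_assoc, he, hl]⟩

theorem Module.Projective.of_extendsFromKer [Module.Projective R P] (hf : Function.Surjective f)
    (h : ExtendsFromKer f (ker f)) : Module.Projective R M := by
  obtain ⟨e, he⟩ := h LinearMap.id
  have hk : ker f ≤ ker (LinearMap.id - (ker f).subtype ∘ₗ e) := fun x hx => by
    have := congrArg Subtype.val (LinearMap.congr_fun he ⟨x, hx⟩)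
    simp only [LinearMap.comp_apply, Submodule.subtype_apply, LinearMap.id_apply] at this
    simp [this]
  let t : M →ₗ[R] P := (ker f).liftQ _ hk ∘ₗ (f.quotKerEquivOfSurjective hf).symm.toLinearMap
  refine Module.Projective.of_split t f (LinearMap.ext fun m => ?_)
  obtain ⟨p, rfl⟩ := hf m
  have : (f.quotKerEquivOfSurjective hf).symm (f p) = (ker f).mkQ p := by
    rw [LinearEquiv.symm_apply_eq]; rfl
  have h0 : f (e p : P) = 0 := (e p).2
  simp only [t, LinearMap.comp_apply, LinearEquiv.coe_coe, this, LinearMap.id_apply]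
  change f (p - (e p : P)) = f p
  rw [map_sub, h0, sub_zero]

variable {a : X →ₗ[R] I} {b : I →ₗ[R] Y}

/-- `Ext¹(M, X) = 0` in terms of an injective copresentation of `X`. -/
theorem extendsFromKer_iff_lifts [Module.Projective R P] (hf : Function.Surjective f)
    (hI : ExtendsFromKer f I) (ha : Function.Injective a) (hab : b ∘ₗ a = 0)
    (hex : ker b ≤ range a) (hb : Function.Surjective b) :
    ExtendsFromKer f X ↔ ∀ m : M →ₗ[R] Y, ∃ l : M →ₗ[R] I, b ∘ₗ l = m := by
  let ainv := LinearEquiv.ofInjective a ha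
  have hainv : ∀ y, a (ainv.symm y) = y := fun y =>
    congrArg Subtype.val (ainv.apply_symm_apply y)
  constructor
  · intro h m
    obtain ⟨l, hl⟩ := Module.projective_lifting_property b (m ∘ₗ f) hb
    have key : ∀ x : ker f, (l ∘ₗ (ker f).subtype) x ∈ range a := fun x => hex <| by
      have := LinearMap.congr_fun hl x
      have hx : f x = 0 := x.2
      simpa [hx] using this
    obtain ⟨e, he⟩ := h (ainv.symm.toLinearMap ∘ₗ (l ∘ₗ (ker f).subtype).codRestrict _ key)
    have hk : ker f ≤ ker (l - a ∘ₗ e) := fun x hx => by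
      have := congrArg a (LinearMap.congr_fun he ⟨x, hx⟩)
      simp only [LinearMap.comp_apply, LinearEquiv.coe_coe, hainv, codRestrict_apply,
        Submodule.subtype_apply] at this
      simp [this]
    refine ⟨(ker f).liftQ _ hk ∘ₗ (f.quotKerEquivOfSurjective hf).symm.toLinearMap,
      LinearMap.ext fun y => ?_⟩
    obtain ⟨p, rfl⟩ := hf y
    have h1 : (f.quotKerEquivOfSurjective hf).symm (f p) = (ker f).mkQ p := by
      rw [LinearEquiv.symm_apply_eq]; rfl
    have h2 := LinearMap.congr_fun hl p
    have h3 := LinearMap.congr_fun hab (e p)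
    simp only [LinearMap.comp_apply, LinearMap.zero_apply] at h2 h3
    simp only [LinearMap.comp_apply, LinearEquiv.coe_coe, h1]
    change b (l p - a (e p)) = _
    rw [map_sub, h2, h3, sub_zero]
  · intro h g
    obtain ⟨e, he⟩ := hI (a ∘ₗ g)
    have hk : ker f ≤ ker (b ∘ₗ e) := fun x hx => by
      have h1 := LinearMap.congr_fun he ⟨x, hx⟩
      have h3 := LinearMap.congr_fun hab (g ⟨x, hx⟩)
      simp only [LinearMap.comp_apply, Submodule.subtype_apply, LinearMap.zero_apply] at h1 h3
      simp [h1, h3]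
    obtain ⟨l, hl⟩ := h ((ker f).liftQ _ hk ∘ₗ (f.quotKerEquivOfSurjective hf).symm.toLinearMap)
    have key : ∀ p, (e - l ∘ₗ f) p ∈ range a := fun p => hex <| by
      have h1 : (f.quotKerEquivOfSurjective hf).symm (f p) = (ker f).mkQ p := by
        rw [LinearEquiv.symm_apply_eq]; rfl
      have h2 := LinearMap.congr_fun hl (f p)
      simp only [LinearMap.comp_apply, LinearEquiv.coe_coe, h1] at h2
      rw [LinearMap.mem_ker, LinearMap.sub_apply, map_sub, LinearMap.comp_apply, h2, sub_eq_zero]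
      rfl
    refine ⟨ainv.symm.toLinearMap ∘ₗ (e - l ∘ₗ f).codRestrict _ key,
      LinearMap.ext fun x => ha ?_⟩
    have h1 := LinearMap.congr_fun he x
    have hx : f x = 0 := x.2
    simp only [LinearMap.comp_apply, Submodule.subtype_apply] at h1
    simp only [LinearMap.comp_apply, LinearEquiv.coe_coe, hainv, codRestrict_apply,
        Submodule.subtype_apply, LinearMap.sub_apply, h1, hx, map_zero, sub_zero]

/-- `Ext¹(M, Y) = 0` in terms of lifting maps from the syzygy `ker f` along an
epimorphism onto `Y` from an injective module. -/
theorem extendsFromKer_iff_ker_lifts [Module.Projective R P] (hI : ExtendsFromKer f I)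
    (hb : Function.Surjective b) :
    ExtendsFromKer f Y ↔ ∀ m : ker f →ₗ[R] Y, ∃ l : ker f →ₗ[R] I, b ∘ₗ l = m := by
  refine forall_congr' fun m => ⟨?_, ?_⟩
  · rintro ⟨e, he⟩
    obtain ⟨l, hl⟩ := Module.projective_lifting_property b e hb
    exact ⟨l ∘ₗ (ker f).subtype, by rw [← comp_assoc, hl, he]⟩
  · rintro ⟨l, hl⟩
    obtain ⟨e, he⟩ := hI l
    exact ⟨b ∘ₗ e, by rw [comp_assoc, he, hl]⟩

end Extension

section ExtensionDual

variable {R : Type*} [Ring R] {P M : Type*} [AddCommGroup P] [Module R P]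
  [AddCommGroup M] [Module R M] {f : P →ₗ[R] M}

theorem ExtendsFromKer.characterModule_of_projective {X : Type*} [AddCommGroup X] [Module Rᵐᵒᵖ X]
    [Module.Projective Rᵐᵒᵖ X] : ExtendsFromKer f (CharacterModule X) :=
  fun h => exists_extend_characterModule _ (ker f).injective_subtype h

theorem ExtendsFromKer.characterModule_congr {X Y : Type*} [AddCommGroup X] [Module Rᵐᵒᵖ X]
    [AddCommGroup Y] [Module Rᵐᵒᵖ Y] (e : X ≃ₗ[Rᵐᵒᵖ] Y) :
    ExtendsFromKer f (CharacterModule X) ↔ ExtendsFromKer f (CharacterModule Y) := by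
  constructor <;> intro h
  · exact h.of_retract (rightDual e.toLinearMap) (rightDual e.symm.toLinearMap)
      (by ext c y; simp)
  · exact h.of_retract (rightDual e.symm.toLinearMap) (rightDual e.toLinearMap)
      (by ext c y; simp)

theorem ExtendsFromKer.characterModule_pi {ι : Type*} [Fintype ι] {X : ι → Type*}
    [∀ i, AddCommGroup (X i)] [∀ i, Module Rᵐᵒᵖ (X i)] :
    ExtendsFromKer f (CharacterModule (∀ i, X i)) ↔
      ∀ i, ExtendsFromKer f (CharacterModule (X i)) := by
  classical
  constructor
  · intro h i
    exact h.of_retract (rightDual (LinearMap.proj i)) (rightDual (LinearMap.single Rᵐᵒᵖ X i))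
      (by ext c y; simp)
  · intro h g
    choose e he using fun i => h i (rightDual (LinearMap.single Rᵐᵒᵖ X i) ∘ₗ g)
    refine ⟨∑ i, rightDual (LinearMap.proj i) ∘ₗ e i, ?_⟩
    ext x y
    have h1 : ∀ i z, (e i x) z = g x (Pi.single i z) := fun i z =>
      congrArg (fun a : CharacterModule (X i) => a z) (LinearMap.congr_fun (he i) x)
    simp only [LinearMap.comp_apply, Submodule.subtype_apply, LinearMap.sum_apply,
      characterModule_sum_apply, rightDual_apply, LinearMap.proj_apply, h1]
    rw [← map_sum, Finset.univ_sum_single]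

theorem ExtendsFromKer.characterModule_sum {s : ℕ} {A : Fin s → Type*}
    [∀ i, AddCommGroup (A i)] [∀ i, Module Rᵐᵒᵖ (A i)] {n : Fin s → ℕ} :
    ExtendsFromKer f (CharacterModule (∀ i, Fin (n i) → A i)) ↔
      ∀ i, n i ≠ 0 → ExtendsFromKer f (CharacterModule (A i)) := by
  simp only [ExtendsFromKer.characterModule_pi]
  refine forall_congr' fun i => ⟨fun h hi => h ⟨0, Nat.pos_of_ne_zero hi⟩, fun h k => h ?_⟩
  have := k.2
  omega

end ExtensionDual

section Radical

variable {R : Type*} [Ring R]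

theorem mem_jacobson_mulOpposite_iff [IsArtinianRing R] [IsArtinianRing Rᵐᵒᵖ] (x : R) :
    MulOpposite.op x ∈ Ring.jacobson Rᵐᵒᵖ ↔ x ∈ Ring.jacobson R := by
  constructor
  · intro hx
    let φ : Rᵐᵒᵖ →+* (R ⧸ Ring.jacobson R)ᵐᵒᵖ := (Ideal.Quotient.mk (Ring.jacobson R)).op
    have hφ : Function.Surjective φ := fun y => by
      obtain ⟨z, hz⟩ := Ideal.Quotient.mk_surjective y.unop
      exact ⟨MulOpposite.op z, MulOpposite.unop_injective hz⟩
    have : RingHomSurjective φ := ⟨hφ⟩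
    have h := Ring.le_comap_jacobson φ hx
    rw [IsSemisimpleRing.jacobson_eq_bot (R ⧸ Ring.jacobson R)ᵐᵒᵖ] at h
    exact Ideal.Quotient.eq_zero_iff_mem.mp (MulOpposite.op_injective h)
  · intro hx
    let φ : R →+* (Rᵐᵒᵖ ⧸ Ring.jacobson Rᵐᵒᵖ)ᵐᵒᵖ :=
      (Ideal.Quotient.mk (Ring.jacobson Rᵐᵒᵖ)).op.comp (RingEquiv.opOp R).toRingHom
    have hφ : Function.Surjective φ := fun y => by
      obtain ⟨z, hz⟩ := Ideal.Quotient.mk_surjective y.unop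
      exact ⟨z.unop, MulOpposite.unop_injective hz⟩
    have : RingHomSurjective φ := ⟨hφ⟩
    have h := Ring.le_comap_jacobson φ hx
    rw [IsSemisimpleRing.jacobson_eq_bot (Rᵐᵒᵖ ⧸ Ring.jacobson Rᵐᵒᵖ)ᵐᵒᵖ] at h
    exact Ideal.Quotient.eq_zero_iff_mem.mp (MulOpposite.op_injective h)

theorem ExtendsFromKer.of_isSemisimpleModule [IsArtinianRing R] [IsArtinianRing Rᵐᵒᵖ]
    {P M : Type*} [AddCommGroup P] [Module R P] [AddCommGroup M] [Module R M] {f : P →ₗ[R] M}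
    (hf : ExtendsFromKer f (CharacterModule (Rᵐᵒᵖ ⧸ Ring.jacobson Rᵐᵒᵖ)))
    (Y : Type*) [AddCommGroup Y] [Module R Y] [IsSemisimpleModule R Y] : ExtendsFromKer f Y := by
  set J := Ring.jacobson Rᵐᵒᵖ
  let orbit (φ : CharacterModule Y) : Y →ₗ[R] CharacterModule Rᵐᵒᵖ :=
    { toFun := fun y => AddMonoidHom.mk' (fun r => φ (r.unop • y)) fun r r' => by
        rw [MulOpposite.unop_add, add_smul, map_add]
      map_add' := fun y y' => CharacterModule.ext _ fun r =>
        (congrArg φ (smul_add r.unop y y')).trans (map_add φ _ _)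
      map_smul' := fun s y => CharacterModule.ext _ fun r => congrArg φ (mul_smul r.unop s y).symm }
  have horbit (φ : CharacterModule Y) (y : Y) :
      orbit φ y ∈ range (rightDual J.mkQ : _ →ₗ[R] CharacterModule Rᵐᵒᵖ) := by
    refine rightDual_exact J.mkQ_surjective _ (CharacterModule.ext _ fun r => ?_)
    have hr : r.1 ∈ J := by simpa using r.2
    have hr' : r.1.unop ∈ Ring.jacobson R := (mem_jacobson_mulOpposite_iff _).mp hr
    have h0 : r.1.unop • y = 0 :=
      Module.mem_annihilator.mp (IsSemisimpleModule.jacobson_le_annihilator R Y hr') y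
    exact (congrArg φ h0).trans (map_zero φ)
  have hinj := rightDual_injective J.mkQ_surjective
  let ι : Y →ₗ[R] (CharacterModule Y → CharacterModule (Rᵐᵒᵖ ⧸ J)) := LinearMap.pi fun φ =>
    (LinearEquiv.ofInjective _ hinj).symm.toLinearMap ∘ₗ (orbit φ).codRestrict _ (horbit φ)
  have hιapply (y : Y) (φ : CharacterModule Y) : rightDual J.mkQ (ι y φ) = orbit φ y :=
    congrArg Subtype.val ((LinearEquiv.ofInjective _ hinj).apply_symm_apply ⟨_, horbit φ y⟩)
  have hι : Function.Injective ι := (injective_iff_map_eq_zero ι).mpr fun y hy =>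
    CharacterModule.eq_zero_of_character_apply fun φ => by
      have h1 := hιapply y φ
      rw [hy, Pi.zero_apply, map_zero] at h1
      have h2 := congrArg (fun c : CharacterModule Rᵐᵒᵖ => c 1) h1
      exact (congrArg φ (one_smul R y)).symm.trans h2.symm
  have htors : Module.IsTorsionBySet R (CharacterModule Y → CharacterModule (Rᵐᵒᵖ ⧸ J))
      (Ring.jacobson R) := fun w a => funext fun φ => CharacterModule.ext _ fun q => by
    obtain ⟨r, rfl⟩ := J.mkQ_surjective q
    have hr : MulOpposite.op a.1 * r ∈ J :=
      J.mul_mem_right _ ((mem_jacobson_mulOpposite_iff _).mpr a.2)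
    have h0 : MulOpposite.op a.1 • J.mkQ r = 0 := by
      rw [← map_smul]; exact (Submodule.Quotient.mk_eq_zero J).mpr hr
    exact (congrArg (w φ) h0).trans (map_zero (w φ))
  have : IsSemisimpleModule R (CharacterModule Y → CharacterModule (Rᵐᵒᵖ ⧸ J)) := by
    let _ := htors.module
    exact htors.isSemisimpleModule_iff.mp inferInstance
  obtain ⟨ρ, hρ⟩ := IsSemisimpleModule.extension_property ι hι LinearMap.id
  exact (ExtendsFromKer.pi fun _ => hf).of_retract ι ρ hρ

/-- Over an artinian ring, vanishing of `Ext¹` against the dual of `R / rad R` (as a right module)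
forces vanishing of `Ext¹` against all modules. -/
theorem ExtendsFromKer.of_radical_quotient {R : Type u} [Ring R] [IsArtinianRing R]
    [IsArtinianRing Rᵐᵒᵖ] {P M : Type u} [AddCommGroup P] [Module R P] [AddCommGroup M] [Module R M]
    [Module.Projective R P] {f : P →ₗ[R] M}
    (hf : ExtendsFromKer f (CharacterModule (Rᵐᵒᵖ ⧸ Ring.jacobson Rᵐᵒᵖ)))
    (Y : Type u) [AddCommGroup Y] [Module R Y] : ExtendsFromKer f Y :=
  IsSemiprimaryRing.induction R R Y (P := fun Y _ _ _ => ExtendsFromKer f Y)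
    (fun Y _ _ _ _ _ _ => .of_isSemisimpleModule hf Y)
    (fun _ _ _ _ _ hN hQ => .of_submodule_quotient _ hN hQ)

end Radical

section SyzygyMatrix

variable {R : Type u} [Ring R] {s : ℕ} {A Q : Fin s → ModuleCat.{u} Rᵐᵒᵖ}

/-- Every map from `N` to the character module of `ker g` lifts to the character module
of the source of `g`. -/
def LiftsToDual (N : Type u) [AddCommGroup N] [Module R N] {X Y : Type u} [AddCommGroup X]
    [Module Rᵐᵒᵖ X] [AddCommGroup Y] [Module Rᵐᵒᵖ Y] (g : X →ₗ[Rᵐᵒᵖ] Y) : Prop :=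
  ∀ m : N →ₗ[R] CharacterModule (ker g), ∃ l : N →ₗ[R] CharacterModule X,
    rightDual (ker g).subtype ∘ₗ l = m

variable {P M : Type u} [AddCommGroup P] [Module R P] [AddCommGroup M] [Module R M]
  [Module.Projective R P] {f : P →ₗ[R] M}

theorem extendsFromKer_iff_liftsToDual {X Y : Type u} [AddCommGroup X]
    [Module Rᵐᵒᵖ X] [AddCommGroup Y] [Module Rᵐᵒᵖ Y] [Module.Projective Rᵐᵒᵖ X]
    {g : X →ₗ[Rᵐᵒᵖ] Y} (hg : Function.Surjective g) (hf : Function.Surjective f) :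
    ExtendsFromKer f (CharacterModule Y) ↔ LiftsToDual M g :=
  extendsFromKer_iff_lifts hf .characterModule_of_projective (rightDual_injective hg)
    (LinearMap.ext fun c => CharacterModule.ext _ fun x =>
      (congrArg c x.2).trans (map_zero c)) (rightDual_exact hg)
    (rightDual_surjective (ker g).injective_subtype)

theorem LiftsToDual.of_projective {X Y : Type u} [AddCommGroup X] [Module Rᵐᵒᵖ X]
    [AddCommGroup Y] [Module Rᵐᵒᵖ Y] (g : X →ₗ[Rᵐᵒᵖ] Y) [Module.Projective R M] :
    LiftsToDual M g := fun m =>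
  Module.projective_lifting_property _ m (rightDual_surjective (ker g).injective_subtype)

variable {g : ∀ i, Q i →ₗ[Rᵐᵒᵖ] A i} {B : Matrix (Fin s) (Fin s) ℕ}

/-- Dimension shift: the syzygy matrix governs vanishing of `Ext` at the syzygy `ker f`. -/
theorem liftsToDual_ker_iff (hQ : ∀ i, Module.Projective Rᵐᵒᵖ (Q i))
    (hg : ∀ i, Function.Surjective (g i))
    (hB : ∀ i, Nonempty (ker (g i) ≃ₗ[Rᵐᵒᵖ] ((j : Fin s) → Fin (B i j) → A j)))
    (hf : Function.Surjective f) (i : Fin s) :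
    LiftsToDual (ker f) (g i) ↔ ∀ j, B i j ≠ 0 → LiftsToDual M (g j) := by
  have := hQ
  obtain ⟨e⟩ := hB i
  rw [LiftsToDual, ← extendsFromKer_iff_ker_lifts .characterModule_of_projective
    (rightDual_surjective (ker (g i)).injective_subtype), ExtendsFromKer.characterModule_congr e,
    ExtendsFromKer.characterModule_sum]
  exact forall₂_congr fun j _ => extendsFromKer_iff_liftsToDual (hg j) hf

theorem Matrix.pow_succ_apply_ne_zero_iff (B : Matrix (Fin s) (Fin s) ℕ) (k : ℕ) (i j : Fin s) :
    (B ^ (k + 1)) i j ≠ 0 ↔ ∃ l, (B ^ k) i l ≠ 0 ∧ B l j ≠ 0 := by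
  simp [pow_succ, Matrix.mul_apply, Finset.sum_eq_zero_iff]

theorem LiftsToDual.of_pdimLE (hQ : ∀ i, Module.Projective Rᵐᵒᵖ (Q i))
    (hg : ∀ i, Function.Surjective (g i))
    (hB : ∀ i, Nonempty (ker (g i) ≃ₗ[Rᵐᵒᵖ] ((j : Fin s) → Fin (B i j) → A j))) :
    ∀ (k : ℕ) (M : ModuleCat.{u} R), PdimLE R k M → ∀ i j, (B ^ k) i j ≠ 0 → LiftsToDual M (g j)
  | 0, M, h, _, j, _ => by
    have : Module.Projective R M := h
    exact .of_projective _
  | k + 1, M, ⟨P, f, hP, hf, hk⟩, i, j, hij => by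
    obtain ⟨l, hil, hlj⟩ := (Matrix.pow_succ_apply_ne_zero_iff B k i j).mp hij
    exact (liftsToDual_ker_iff hQ hg hB hf l).mp (of_pdimLE hQ hg hB k _ hk i l hil) j hlj

theorem PdimLE.of_succ_of_liftsToDual (hQ : ∀ i, Module.Projective Rᵐᵒᵖ (Q i))
    (hg : ∀ i, Function.Surjective (g i))
    (hB : ∀ i, Nonempty (ker (g i) ≃ₗ[Rᵐᵒᵖ] ((j : Fin s) → Fin (B i j) → A j)))
    (h0 : ∀ M : ModuleCat.{u} R, PdimLE R 1 M → (∀ j, LiftsToDual M (g j)) → PdimLE R 0 M) :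
    ∀ (k : ℕ) (M : ModuleCat.{u} R), PdimLE R (k + 1) M →
      (∀ i j, (B ^ k) i j ≠ 0 → LiftsToDual M (g j)) → PdimLE R k M
  | 0, M, h, hM => h0 M h fun j => hM j j (by simp)
  | k + 1, M, ⟨P, f, hP, hf, hk⟩, hM => by
    refine ⟨P, f, hP, hf, of_succ_of_liftsToDual hQ hg hB h0 k _ hk fun i l hil => ?_⟩
    exact (liftsToDual_ker_iff hQ hg hB hf l).mpr fun j hlj =>
      hM i j ((Matrix.pow_succ_apply_ne_zero_iff B k i j).mpr ⟨l, hil, hlj⟩)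

theorem PdimLE.of_succ_of_le {d : ℕ}
    (h : ∀ M : ModuleCat.{u} R, PdimLE R (d + 1) M → PdimLE R d M) {n : ℕ} (hn : d ≤ n) :
    ∀ M : ModuleCat.{u} R, PdimLE R (n + 1) M → PdimLE R n M := by
  induction n, hn using Nat.le_induction with
  | base => exact h
  | succ n _ ih =>
    rintro M ⟨P, f, hP, hf, hk⟩
    exact ⟨P, f, hP, hf, ih _ hk⟩

theorem bigFinDim_le_of_pdimLE_succ {d : ℕ}
    (h : ∀ M : ModuleCat.{u} R, PdimLE R (d + 1) M → PdimLE R d M) : bigFinDim R ≤ d := by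
  refine sSup_le ?_
  rintro _ ⟨hfin, M, rfl⟩
  obtain ⟨n, hn⟩ : ∃ n, PdimLE R n M := by
    by_contra! hne
    refine hfin (sInf_eq_top.mpr ?_)
    rintro _ ⟨n, -, hn⟩
    exact absurd hn (hne n)
  obtain hle | hle := le_total n d
  · exact (sInf_le ⟨n, rfl, hn⟩ : pdim R M ≤ n).trans (by exact_mod_cast hle)
  · induction n, hle using Nat.le_induction with
    | base => exact sInf_le ⟨d, rfl, hn⟩
    | succ n hdn ih => exact ih (PdimLE.of_succ_of_le h hdn M hn)

theorem Matrix.exists_pow_succ_apply_ne_zero {B : Matrix (Fin s) (Fin s) ℕ} {d : ℕ}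
    {C : Matrix (Fin s) (Fin s) ℚ}
    (hC : (B.map (Nat.cast : ℕ → ℚ)) ^ d = C * (B.map (Nat.cast : ℕ → ℚ)) ^ (d + 1))
    {i j : Fin s} (hij : (B ^ d) i j ≠ 0) : ∃ l, (B ^ (d + 1)) l j ≠ 0 := by
  have hmap (k : ℕ) : B.map (Nat.cast : ℕ → ℚ) ^ k = (B ^ k).map (Nat.cast : ℕ → ℚ) :=
    (map_pow (Nat.castRingHom ℚ).mapMatrix B k).symm
  by_contra! h
  refine hij ?_
  have := congrFun (congrFun hC i) j
  rw [hmap, hmap, Matrix.mul_apply] at this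
  simpa [h] using this

end SyzygyMatrix

/-- In the setting of Statement 11 : if `d` is the least
nonnegative integer such that `B^d = C ⬝ B^(d+1)` for some rational `s × s` matrix
`C`, then `l Fin dim Λ ≤ d`. -/
theorem bigFinDim_le_matrix_stability_degree (K : Type u) [Field K]
    (Λ : Type u) [Ring Λ] [Algebra K Λ] [FiniteDimensional K Λ]
    (T : ModuleCat.{u} Λᵐᵒᵖ) (hT : Module.Finite Λᵐᵒᵖ ↥T)
    (cT : SyzygyChain Λᵐᵒᵖ T)
    (s : ℕ) (A : Fin s → ModuleCat.{u} Λᵐᵒᵖ) (hst : HasSyzygyType Λᵐᵒᵖ cT s A)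
    (hemb : EmbedsIn Λᵐᵒᵖ (radQuot Λᵐᵒᵖ) T)
    (cA : ∀ i, SyzygyChain Λᵐᵒᵖ (A i))
    (B : Matrix (Fin s) (Fin s) ℕ)
    (hB : ∀ i, Nonempty (↥((cA i).Ω 1) ≃ₗ[Λᵐᵒᵖ] ((j : Fin s) → Fin (B i j) → ↥(A j))))
    (d : ℕ)
    (hd : IsLeast {k : ℕ | ∃ C : Matrix (Fin s) (Fin s) ℚ,
      (B.map (Nat.cast : ℕ → ℚ)) ^ k = C * (B.map (Nat.cast : ℕ → ℚ)) ^ (k + 1)} d) :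
    bigFinDim Λ ≤ (d : ℕ∞) := by
  have : IsArtinianRing Λ := IsArtinianRing.of_finite K Λ
  have : IsArtinianRing Λᵐᵒᵖ := IsArtinianRing.of_finite K Λᵐᵒᵖ
  have e0 (i : Fin s) := (cA i).iso0.some
  have hker (i : Fin s) : ker ((e0 i).toLinearMap ∘ₗ (cA i).f 0) = ker ((cA i).f 0) :=
    LinearMap.ker_comp_of_ker_eq_bot _ (e0 i).ker
  have hQ (i : Fin s) : Module.Projective Λᵐᵒᵖ ((cA i).P 0) := (cA i).projective 0
  have hg (i : Fin s) : Function.Surjective ((e0 i).toLinearMap ∘ₗ (cA i).f 0) :=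
    (e0 i).surjective.comp ((cA i).surj 0)
  have hB' (i : Fin s) : Nonempty (ker ((e0 i).toLinearMap ∘ₗ (cA i).f 0) ≃ₗ[Λᵐᵒᵖ]
      ((j : Fin s) → Fin (B i j) → A j)) := by
    obtain ⟨e⟩ := (cA i).isoSucc 0
    obtain ⟨e'⟩ := hB i
    exact ⟨LinearEquiv.ofEq _ _ (hker i) ≪≫ₗ e.symm ≪≫ₗ e'⟩
  obtain ⟨C, hC⟩ := hd.1
  refine bigFinDim_le_of_pdimLE_succ fun M hM => ?_
  refine PdimLE.of_succ_of_liftsToDual hQ hg hB' ?_ d M hM fun i j hij => ?_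
  · rintro N ⟨P, f, hP, hf, hk⟩ hN
    have : Module.Projective Λ (ker f) := hk
    obtain ⟨m, ⟨eT⟩⟩ := hst.2.2.2 0
    obtain ⟨eT'⟩ := cT.iso0
    obtain ⟨ι, hι⟩ := hemb
    have hT' : ExtendsFromKer f (CharacterModule T) := by
      rw [ExtendsFromKer.characterModule_congr (eT'.symm ≪≫ₗ eT),
        ExtendsFromKer.characterModule_sum]
      exact fun j _ => (extendsFromKer_iff_liftsToDual (hg j) hf).mpr (hN j)
    have hrad : ExtendsFromKer f (CharacterModule (Λᵐᵒᵖ ⧸ Ring.jacobson Λᵐᵒᵖ)) :=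
      hT'.of_surjective (rightDual ι) (rightDual_surjective hι)
    exact Module.Projective.of_extendsFromKer hf (hrad.of_radical_quotient _)
  · obtain ⟨l, hl⟩ := Matrix.exists_pow_succ_apply_ne_zero hC hij
    exact LiftsToDual.of_pdimLE hQ hg hB' (d + 1) M hM l j hl
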